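/- For every σ > 0 and every α with 1/2 ≤ α ≤ 1, the high-power asymptotics of capacity is: lim_{A → ∞} ( C(A, αA) − log(A/σ) ) = −(1/2)·log(2πe). -/

import Mathlib

open MeasureTheory ProbabilityTheory Real Filter Set
open scoped Classical Topology

/-- Kullback--Leibler divergence (in nats), valued in the extended reals:
`D(P ∥ R) = ∫ log (dP/dR) dP` if `P ≪ R` and the log-likelihood ratio is
`P`-integrable, and `+∞` otherwise. -/
noncomputable def klDiv {α : Type*} [MeasurableSpace α] (P R : Measure α) : EReal :=
  if P ≪ R ∧ Integrable (llr P R) P then ((∫ x, llr P R x ∂P : ℝ) : EReal) else ⊤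

/-- Joint law of `(X, Y)` where `X ~ Q` and `Y = X + Z` with `Z ~ N(0, σ²)`
independent of `X`. -/
noncomputable def jointLaw (σ : ℝ) (Q : Measure ℝ) : Measure (ℝ × ℝ) :=
  (Q.prod (gaussianReal 0 ⟨σ ^ 2, sq_nonneg σ⟩)).map (fun p => (p.1, p.1 + p.2))

/-- Mutual information `I(X;Y)` in nats: the KL divergence of the joint law of
`(X, Y)` from the product of its marginal laws. -/
noncomputable def mutualInfo (σ : ℝ) (Q : Measure ℝ) : EReal :=
  klDiv (jointLaw σ Q) (((jointLaw σ Q).map Prod.fst).prod ((jointLaw σ Q).map Prod.snd))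

/-- Capacity `C(A, E)` of the channel `Y = X + Z`, `Z ~ N(0, σ²)`, with peak-power
constraint `A` (i.e. `P(0 ≤ X ≤ A) = 1`) and average-power constraint `E[X] ≤ E`:
the supremum of the mutual information over all admissible input laws. -/
noncomputable def capacity (σ A E : ℝ) : EReal :=
  ⨆ Q ∈ {Q : Measure ℝ | IsProbabilityMeasure Q ∧ Q (Set.Icc 0 A) = 1 ∧
      ∫⁻ x, ENNReal.ofReal x ∂Q ≤ ENNReal.ofReal E}, mutualInfo σ Q

open scoped NNReal ENNReal

noncomputable def vv (σ : ℝ) : ℝ≥0 := ⟨σ ^ 2, sq_nonneg σ⟩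

lemma vv_coe (σ : ℝ) : ((vv σ : ℝ≥0) : ℝ) = σ ^ 2 := rfl

lemma vv_ne {σ : ℝ} (hσ : 0 < σ) : vv σ ≠ 0 := by
  intro h
  have := congrArg (fun x : ℝ≥0 => (x : ℝ)) h
  simp only [vv_coe, NNReal.coe_zero] at this
  exact absurd this (by positivity)

/-- output density -/
noncomputable def outF (σ : ℝ) (Q : Measure ℝ) (y : ℝ) : ℝ≥0∞ := ∫⁻ x, gaussianPDF x (vv σ) y ∂Q

lemma meas_pdf (v : ℝ≥0) : Measurable (fun p : ℝ × ℝ => gaussianPDF p.1 v p.2) := by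
  unfold gaussianPDF gaussianPDFReal
  fun_prop

lemma meas_outF (σ : ℝ) (Q : Measure ℝ) [IsProbabilityMeasure Q] : Measurable (outF σ Q) :=
  (meas_pdf (vv σ)).lintegral_prod_left'

lemma jointLaw_eq {σ : ℝ} (hσ : 0 < σ) (Q : Measure ℝ) [IsProbabilityMeasure Q] :
    jointLaw σ Q = (Q.prod volume).withDensity (fun p => gaussianPDF p.1 (vv σ) p.2) := by
  refine Measure.ext_of_lintegral _ fun k hk => ?_
  change ∫⁻ p, k p ∂((Q.prod (gaussianReal 0 (vv σ))).map (fun p => (p.1, p.1 + p.2))) = _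
  rw [lintegral_map hk (by fun_prop), lintegral_prod _ (by fun_prop),
    lintegral_withDensity_eq_lintegral_mul _ (meas_pdf _) hk,
    lintegral_prod _ ((meas_pdf _).mul hk).aemeasurable]
  refine lintegral_congr fun x => ?_
  have h1 : ∫⁻ z, k (x, x + z) ∂(gaussianReal 0 (vv σ)) =
      ∫⁻ y, k (x, y) ∂((gaussianReal 0 (vv σ)).map (fun z => x + z)) := by
    rw [lintegral_map (by fun_prop) (by fun_prop)]
  rw [h1, gaussianReal_map_const_add, zero_add, gaussianReal_of_var_ne_zero _ (vv_ne hσ),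
    lintegral_withDensity_eq_lintegral_mul _ (measurable_gaussianPDF _ _) (by fun_prop)]
  rfl

lemma jointLaw_fst (σ : ℝ) (Q : Measure ℝ) [IsProbabilityMeasure Q] :
    (jointLaw σ Q).map Prod.fst = Q := by
  unfold jointLaw
  rw [Measure.map_map (by fun_prop) (by fun_prop)]
  change (Q.prod (gaussianReal 0 (vv σ))).map Prod.fst = Q
  simp

lemma jointLaw_snd {σ : ℝ} (hσ : 0 < σ) (Q : Measure ℝ) [IsProbabilityMeasure Q] :
    (jointLaw σ Q).map Prod.snd = volume.withDensity (outF σ Q) := by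
  refine Measure.ext_of_lintegral _ fun k hk => ?_
  have hk2 : Measurable (fun p : ℝ × ℝ => k p.2) := hk.comp measurable_snd
  have hm2 : Measurable (fun p : ℝ × ℝ => gaussianPDF p.1 (vv σ) p.2 * k p.2) :=
    (meas_pdf (vv σ)).mul hk2
  have e1 : ∫⁻ y, k y ∂((jointLaw σ Q).map Prod.snd) = ∫⁻ p, k p.2 ∂(jointLaw σ Q) :=
    lintegral_map hk measurable_snd
  have e2 : ∫⁻ p, k p.2 ∂(jointLaw σ Q) =
      ∫⁻ p : ℝ × ℝ, gaussianPDF p.1 (vv σ) p.2 * k p.2 ∂(Q.prod volume) := by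
    rw [jointLaw_eq hσ]
    exact lintegral_withDensity_eq_lintegral_mul _ (meas_pdf (vv σ)) hk2
  have e3 : ∫⁻ p : ℝ × ℝ, gaussianPDF p.1 (vv σ) p.2 * k p.2 ∂(Q.prod volume) =
      ∫⁻ y, ∫⁻ x, gaussianPDF x (vv σ) y * k y ∂Q :=
    lintegral_prod_symm _ hm2.aemeasurable
  have e4 : ∫⁻ y, k y ∂(volume.withDensity (outF σ Q)) = ∫⁻ y, outF σ Q y * k y :=
    lintegral_withDensity_eq_lintegral_mul _ (meas_outF σ Q) hk
  rw [e1, e2, e3, e4]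
  refine lintegral_congr fun y => ?_
  have hmm : Measurable (fun x => gaussianPDF x (vv σ) y) := by
    unfold gaussianPDF gaussianPDFReal
    fun_prop
  rw [lintegral_mul_const (k y) hmm, outF]

lemma pdf_le (σ x y : ℝ) : gaussianPDFReal x (vv σ) y ≤ (√(2 * π * σ ^ 2))⁻¹ := by
  unfold gaussianPDFReal
  rw [vv_coe]
  apply mul_le_of_le_one_right (by positivity)
  rw [Real.exp_le_one_iff]
  have : 0 ≤ (y - x) ^ 2 / (2 * σ ^ 2) := by positivity
  rw [neg_div]; linarith

lemma le_pdf {σ A x y : ℝ} (hx : x ∈ Icc 0 A) :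
    (√(2 * π * σ ^ 2))⁻¹ * rexp (-(|y| + A) ^ 2 / (2 * σ ^ 2)) ≤ gaussianPDFReal x (vv σ) y := by
  unfold gaussianPDFReal
  rw [vv_coe]
  have : (y - x) ^ 2 ≤ (|y| + A) ^ 2 := by
    apply sq_le_sq'
    · have := neg_abs_le y; linarith [hx.1, hx.2]
    · have := le_abs_self y; linarith [hx.1, hx.2]
  gcongr

lemma ae_mem {A : ℝ} (Q : Measure ℝ) [IsProbabilityMeasure Q] (hQ : Q (Icc 0 A) = 1) :
    ∀ᵐ x ∂Q, x ∈ Icc 0 A :=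
  (mem_ae_iff_prob_eq_one measurableSet_Icc).2 hQ

lemma outF_le (σ : ℝ) (Q : Measure ℝ) [IsProbabilityMeasure Q] (y : ℝ) :
    outF σ Q y ≤ ENNReal.ofReal ((√(2 * π * σ ^ 2))⁻¹) := by
  unfold outF
  calc _ ≤ ∫⁻ x, ENNReal.ofReal ((√(2 * π * σ ^ 2))⁻¹) ∂Q :=
        lintegral_mono fun x => ENNReal.ofReal_le_ofReal (pdf_le σ x y)
    _ = _ := by simp

lemma le_outF (σ : ℝ) {A : ℝ} (Q : Measure ℝ) [IsProbabilityMeasure Q] (hQ : Q (Icc 0 A) = 1)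
    (y : ℝ) :
    ENNReal.ofReal ((√(2 * π * σ ^ 2))⁻¹ * rexp (-(|y| + A) ^ 2 / (2 * σ ^ 2))) ≤ outF σ Q y := by
  unfold outF
  calc _ = ∫⁻ x, ENNReal.ofReal
          ((√(2 * π * σ ^ 2))⁻¹ * rexp (-(|y| + A) ^ 2 / (2 * σ ^ 2))) ∂Q := by simp
    _ ≤ _ := lintegral_mono_ae (by
        filter_upwards [ae_mem Q hQ] with x hx
        exact ENNReal.ofReal_le_ofReal (le_pdf hx))

lemma outF_ne_top (σ : ℝ) (Q : Measure ℝ) [IsProbabilityMeasure Q] (y : ℝ) : outF σ Q y ≠ ⊤ :=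
  ne_top_of_le_ne_top ENNReal.ofReal_ne_top (outF_le σ Q y)

lemma outF_pos {σ A : ℝ} (hσ : 0 < σ) (Q : Measure ℝ) [IsProbabilityMeasure Q]
    (hQ : Q (Icc 0 A) = 1) (y : ℝ) : 0 < outF σ Q y :=
  lt_of_lt_of_le (by rw [ENNReal.ofReal_pos]; positivity) (le_outF σ Q hQ y)

noncomputable def outf (σ : ℝ) (Q : Measure ℝ) (y : ℝ) : ℝ := (outF σ Q y).toReal

lemma outf_pos {σ A : ℝ} (hσ : 0 < σ) (Q : Measure ℝ) [IsProbabilityMeasure Q]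
    (hQ : Q (Icc 0 A) = 1) (y : ℝ) : 0 < outf σ Q y :=
  ENNReal.toReal_pos (outF_pos hσ Q hQ y).ne' (outF_ne_top σ Q y)

lemma meas_outf (σ : ℝ) (Q : Measure ℝ) [IsProbabilityMeasure Q] : Measurable (outf σ Q) :=
  (meas_outF σ Q).ennreal_toReal

lemma jointLaw_eq2 {σ A : ℝ} (hσ : 0 < σ) (Q : Measure ℝ) [IsProbabilityMeasure Q]
    (hQ : Q (Icc 0 A) = 1) :
    jointLaw σ Q = (Q.prod (volume.withDensity (outF σ Q))).withDensity
      (fun p => gaussianPDF p.1 (vv σ) p.2 / outF σ Q p.2) := by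
  have h1 : Measurable (fun p : ℝ × ℝ => outF σ Q p.2) := (meas_outF σ Q).comp measurable_snd
  have h2 : Measurable (fun p : ℝ × ℝ => gaussianPDF p.1 (vv σ) p.2 / outF σ Q p.2) :=
    (meas_pdf _).div h1
  rw [prod_withDensity_right (meas_outF σ Q), ← withDensity_mul _ h1 h2, jointLaw_eq hσ]
  congr 1
  ext p
  simp only [Pi.mul_apply]
  exact (ENNReal.mul_div_cancel (outF_pos hσ Q hQ _).ne' (outF_ne_top σ Q _)).symm

instance (σ : ℝ) (Q : Measure ℝ) [IsProbabilityMeasure Q] : IsProbabilityMeasure (jointLaw σ Q) := by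
  change IsProbabilityMeasure ((Q.prod (gaussianReal 0 (vv σ))).map (fun p => (p.1, p.1 + p.2)))
  exact Measure.isProbabilityMeasure_map (by fun_prop)

lemma llr_ae {σ A : ℝ} (hσ : 0 < σ) (Q : Measure ℝ) [IsProbabilityMeasure Q]
    (hQ : Q (Icc 0 A) = 1) :
    llr (jointLaw σ Q) (Q.prod (volume.withDensity (outF σ Q))) =ᵐ[jointLaw σ Q]
      fun p => Real.log (gaussianPDFReal p.1 (vv σ) p.2) - Real.log (outf σ Q p.2) := by
  have : IsProbabilityMeasure (volume.withDensity (outF σ Q)) := by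
    rw [← jointLaw_snd hσ]
    exact Measure.isProbabilityMeasure_map (by fun_prop)
  have h := Measure.rnDeriv_withDensity (Q.prod (volume.withDensity (outF σ Q)))
    ((meas_pdf (vv σ)).div ((meas_outF σ Q).comp measurable_snd))
  have h1 := jointLaw_eq2 hσ Q hQ
  have hac : jointLaw σ Q ≪ Q.prod (volume.withDensity (outF σ Q)) := by
    rw [h1]; exact withDensity_absolutelyContinuous _ _
  have h2 := hac.ae_le h
  filter_upwards [h2] with p hp
  rw [llr]
  have h3 : (jointLaw σ Q).rnDeriv (Q.prod (volume.withDensity (outF σ Q))) p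
     = gaussianPDF p.1 (vv σ) p.2 / outF σ Q p.2 := by
    conv_lhs => rw [h1]
    exact hp
  rw [h3, ENNReal.toReal_div, toReal_gaussianPDF]
  exact Real.log_div (gaussianPDFReal_pos _ _ _ (vv_ne hσ)).ne' (outf_pos hσ Q hQ _).ne'

noncomputable def KK (σ : ℝ) : ℝ := -(1 / 2) * Real.log (2 * π * rexp 1) - Real.log σ

lemma log_c {σ : ℝ} (hσ : 0 < σ) : Real.log ((√(2 * π * σ ^ 2))⁻¹) =
    -(1/2) * Real.log (2 * π) - Real.log σ := by
  rw [Real.log_inv, Real.log_sqrt (by positivity), Real.log_mul (by positivity) (by positivity),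
    Real.log_pow]
  push_cast; ring

lemma KK_eq {σ : ℝ} (hσ : 0 < σ) : KK σ = Real.log ((√(2 * π * σ ^ 2))⁻¹) - 1 / 2 := by
  rw [log_c hσ, KK, Real.log_mul (by positivity) (by positivity), Real.log_exp]
  ring

lemma log_pdf {σ : ℝ} (hσ : 0 < σ) (x z : ℝ) : Real.log (gaussianPDFReal x (vv σ) (x + z)) =
    Real.log ((√(2 * π * σ ^ 2))⁻¹) - z ^ 2 / (2 * σ ^ 2) := by
  unfold gaussianPDFReal
  rw [vv_coe, Real.log_mul (by positivity) (by positivity), Real.log_exp]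
  ring

lemma int_sq (σ : ℝ) : Integrable (fun z : ℝ => z ^ 2) (gaussianReal 0 (vv σ)) := by
  have := (memLp_id_gaussianReal (μ := 0) (v := vv σ) 2).integrable_sq
  simpa using this

lemma int_abs (σ : ℝ) : Integrable (fun z : ℝ => |z|) (gaussianReal 0 (vv σ)) := by
  have := (memLp_id_gaussianReal (μ := 0) (v := vv σ) 1).integrable (by simp)
  simpa using this.abs

lemma integral_sq (σ : ℝ) : ∫ z, z ^ 2 ∂(gaussianReal 0 (vv σ)) = σ ^ 2 := by
  have h := variance_fun_id_gaussianReal (μ := 0) (v := vv σ)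
  rw [variance_eq_integral (by fun_prop)] at h
  simpa [vv_coe] using h

lemma int_logf {σ A : ℝ} (hσ : 0 < σ) (hA : 0 < A) (Q : Measure ℝ) [IsProbabilityMeasure Q]
    (hQ : Q (Icc 0 A) = 1) :
    Integrable (fun p : ℝ × ℝ => Real.log (outf σ Q (p.1 + p.2))) 
      (Q.prod (gaussianReal 0 (vv σ))) := by
  have hb : Integrable (fun p : ℝ × ℝ => |Real.log ((√(2 * π * σ ^ 2))⁻¹)| +
      (2 * p.2 ^ 2 + 2 * (2 * A) ^ 2) / (2 * σ ^ 2)) (Q.prod (gaussianReal 0 (vv σ))) := by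
    have := ((int_sq σ).const_mul 2).comp_snd Q
    exact (integrable_const _).add ((this.add (integrable_const _)).div_const _)
  refine hb.mono' ?_ ?_
  · exact ((meas_outf σ Q).comp (measurable_fst.add measurable_snd)).log.aestronglyMeasurable
  · have hx : ∀ᵐ p ∂(Q.prod (gaussianReal 0 (vv σ))), p.1 ∈ Icc 0 A :=
      Measure.quasiMeasurePreserving_fst.ae (ae_mem Q hQ)
    filter_upwards [hx] with p hp
    set y := p.1 + p.2 with hy
    have hpos := outf_pos hσ Q hQ y
    have hu : outf σ Q y ≤ (√(2 * π * σ ^ 2))⁻¹ :=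
      ENNReal.toReal_le_of_le_ofReal (by positivity) (outF_le σ Q y)
    have hl : (√(2 * π * σ ^ 2))⁻¹ * rexp (-(|y| + A) ^ 2 / (2 * σ ^ 2)) ≤ outf σ Q y :=
      (ENNReal.ofReal_le_iff_le_toReal (outF_ne_top σ Q y)).1 (le_outF σ Q hQ y)
    have hu' := Real.log_le_log hpos hu
    have hl' := Real.log_le_log (by positivity) hl
    rw [Real.log_mul (by positivity) (by positivity), Real.log_exp] at hl'
    have hyb : |y| ≤ A + |p.2| := by
      refine (abs_add_le _ _).trans ?_
      rw [abs_of_nonneg hp.1]; linarith [hp.2]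
    have hsq : (|y| + A) ^ 2 ≤ 2 * p.2 ^ 2 + 2 * (2 * A) ^ 2 := by
      have h1 : (|y| + A) ^ 2 ≤ (|p.2| + 2 * A) ^ 2 := by
        apply pow_le_pow_left₀ (by positivity); linarith
      have h2 := sq_abs p.2
      nlinarith [sq_nonneg (|p.2| - 2 * A)]
    have hd : (|y| + A) ^ 2 / (2 * σ ^ 2) ≤ (2 * p.2 ^ 2 + 2 * (2 * A) ^ 2) / (2 * σ ^ 2) := by
      gcongr
    rw [neg_div] at hl'
    have h0 : 0 ≤ (|y| + A) ^ 2 / (2 * σ ^ 2) := by positivity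
    rw [Real.norm_eq_abs, abs_le]
    constructor
    · linarith [neg_abs_le (Real.log ((√(2 * π * σ ^ 2))⁻¹))]
    · linarith [le_abs_self (Real.log ((√(2 * π * σ ^ 2))⁻¹))]

lemma mi_eq {σ A : ℝ} (hσ : 0 < σ) (hA : 0 < A) (Q : Measure ℝ) [IsProbabilityMeasure Q]
    (hQ : Q (Icc 0 A) = 1) :
    mutualInfo σ Q = ((KK σ - ∫ p : ℝ × ℝ, Real.log (outf σ Q (p.1 + p.2))
      ∂(Q.prod (gaussianReal 0 (vv σ))) : ℝ) : EReal) := by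
  have hf := int_logf hσ hA Q hQ
  have hsq : Integrable (fun p : ℝ × ℝ => p.2 ^ 2 / (2 * σ ^ 2)) (Q.prod (gaussianReal 0 (vv σ))) :=
    ((int_sq σ).comp_snd Q).div_const _
  have hc : Integrable (fun p : ℝ × ℝ => Real.log ((√(2 * π * σ ^ 2))⁻¹) - p.2 ^ 2 / (2 * σ ^ 2))
    (Q.prod (gaussianReal 0 (vv σ))) := (integrable_const _).sub hsq
  have hac : jointLaw σ Q ≪ Q.prod (volume.withDensity (outF σ Q)) := by
    rw [jointLaw_eq2 hσ Q hQ]; exact withDensity_absolutelyContinuous _ _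
  have hm : Measurable (fun p : ℝ × ℝ => Real.log (gaussianPDFReal p.1 (vv σ) p.2) -
      Real.log (outf σ Q p.2)) := by
    refine Measurable.sub (Measurable.log ?_) ((meas_outf σ Q).comp measurable_snd).log
    unfold gaussianPDFReal; fun_prop
  have hT : Measurable (fun p : ℝ × ℝ => (p.1, p.1 + p.2)) := by fun_prop
  have hJ : jointLaw σ Q = (Q.prod (gaussianReal 0 (vv σ))).map (fun p => (p.1, p.1 + p.2)) := rfl
  have hg : Integrable (fun p : ℝ × ℝ => Real.log (gaussianPDFReal p.1 (vv σ) p.2) -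
      Real.log (outf σ Q p.2)) (jointLaw σ Q) := by
    rw [hJ, integrable_map_measure hm.aestronglyMeasurable hT.aemeasurable]
    refine (hc.sub hf).congr (ae_of_all _ fun p => ?_)
    simp [log_pdf hσ]
  have hI : Integrable (llr (jointLaw σ Q) (Q.prod (volume.withDensity (outF σ Q))))
      (jointLaw σ Q) := hg.congr (llr_ae hσ Q hQ).symm
  unfold mutualInfo klDiv
  rw [jointLaw_fst, jointLaw_snd hσ, if_pos ⟨hac, hI⟩, integral_congr_ae (llr_ae hσ Q hQ)]
  congr 1
  conv_lhs => rw [hJ]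
  rw [integral_map hT.aemeasurable hm.aestronglyMeasurable]
  simp only [log_pdf hσ]
  rw [integral_sub hc hf, integral_sub (integrable_const _) hsq]
  rw [integral_fun_snd (fun z => z ^ 2 / (2 * σ ^ 2)), integral_div, integral_sq, KK_eq hσ]
  simp
  field_simp

noncomputable def dd (A y : ℝ) : ℝ := max 0 (max (-y) (y - A))

noncomputable def rr (A L y : ℝ) : ℝ := (A + 2 * L)⁻¹ * rexp (-(dd A y) / L)

lemma meas_rr (A L : ℝ) : Measurable (rr A L) := by
  unfold rr dd; fun_prop

lemma lint_rr {A L : ℝ} (hA : 0 < A) (hL : 0 < L) : ∫⁻ y, ENNReal.ofReal (rr A L y) ≤ 1 := by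
  have h1 : ∫⁻ y in Iic 0, ENNReal.ofReal (rexp (-(dd A y) / L)) ≤ ENNReal.ofReal L := by
    calc _ ≤ ∫⁻ y in Iic (0 : ℝ), ENNReal.ofReal (rexp (L⁻¹ * y)) := by
          refine lintegral_mono fun y => ENNReal.ofReal_le_ofReal (Real.exp_le_exp.2 ?_)
          have : -y ≤ dd A y := (le_max_left _ _).trans (le_max_right _ _)
          rw [inv_mul_eq_div]; gcongr; linarith
      _ = _ := by
          rw [← ofReal_integral_eq_lintegral_ofReal (integrableOn_exp_mul_Iic (by positivity) _)
            (ae_of_all _ fun y => (Real.exp_pos _).le), integral_exp_mul_Iic (by positivity)]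
          simp
  have h2 : ∫⁻ y in Ioi A, ENNReal.ofReal (rexp (-(dd A y) / L)) ≤ ENNReal.ofReal L := by
    calc _ ≤ ∫⁻ y in Ioi A, ENNReal.ofReal (rexp (A / L)) * ENNReal.ofReal (rexp (-L⁻¹ * y)) := by
          refine lintegral_mono fun y => ?_
          rw [← ENNReal.ofReal_mul (Real.exp_pos _).le, ← Real.exp_add]
          refine ENNReal.ofReal_le_ofReal (Real.exp_le_exp.2 ?_)
          have : y - A ≤ dd A y := (le_max_right _ _).trans (le_max_right _ _)
          have e : A / L + -L⁻¹ * y = (A - y) / L := by field_simp; ring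
          rw [e]; gcongr; linarith
      _ = _ := by
          have hneg : -L⁻¹ < 0 := by simpa using hL
          rw [lintegral_const_mul _ (by fun_prop),
            ← ofReal_integral_eq_lintegral_ofReal (integrableOn_exp_mul_Ioi hneg _)
            (ae_of_all _ fun y => (Real.exp_pos _).le), integral_exp_mul_Ioi hneg,
            ← ENNReal.ofReal_mul (Real.exp_pos _).le]
          congr 1
          have e : -L⁻¹ * A = -(A / L) := by field_simp
          rw [e, Real.exp_neg]
          have := Real.exp_pos (A / L)
          field_simp
  have h3 : ∫⁻ y in Icc 0 A, ENNReal.ofReal (rexp (-(dd A y) / L)) ≤ ENNReal.ofReal A := by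
    calc _ ≤ ∫⁻ y in Icc 0 A, 1 := by
          refine lintegral_mono fun y => ?_
          rw [ENNReal.ofReal_le_one, Real.exp_le_one_iff]
          apply div_nonpos_of_nonpos_of_nonneg _ hL.le
          have : 0 ≤ dd A y := le_max_left _ _
          linarith
      _ = _ := by simp
  have hu : (univ : Set ℝ) = Iic 0 ∪ (Icc 0 A ∪ Ioi A) := by
    rw [Icc_union_Ioi_eq_Ici hA.le, Iic_union_Ici]
  have h4 : ∫⁻ y, ENNReal.ofReal (rexp (-(dd A y) / L)) ≤ ENNReal.ofReal (A + 2 * L) := by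
    rw [← setLIntegral_univ, hu]
    refine (lintegral_union_le _ _ _).trans ?_
    refine (add_le_add h1 ((lintegral_union_le _ _ _).trans (add_le_add h3 h2))).trans ?_
    rw [← ENNReal.ofReal_add hA.le hL.le, ← ENNReal.ofReal_add hL.le (by positivity)]
    apply ENNReal.ofReal_le_ofReal; linarith
  unfold rr
  have hp : 0 < A + 2 * L := by positivity
  simp_rw [ENNReal.ofReal_mul (inv_nonneg.2 hp.le)]
  rw [lintegral_const_mul _ (by unfold dd; fun_prop)]
  calc _ ≤ ENNReal.ofReal (A + 2 * L)⁻¹ * ENNReal.ofReal (A + 2 * L) := by gcongr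
    _ = 1 := by
      rw [← ENNReal.ofReal_mul (inv_nonneg.2 hp.le), inv_mul_cancel₀ hp.ne']; simp

lemma lint_ratio {σ A L : ℝ} (hσ : 0 < σ) (hA : 0 < A) (hL : 0 < L) (Q : Measure ℝ)
    [IsProbabilityMeasure Q] (hQ : Q (Icc 0 A) = 1) :
    ∫⁻ p : ℝ × ℝ, ENNReal.ofReal (rr A L (p.1 + p.2) / outf σ Q (p.1 + p.2))
      ∂(Q.prod (gaussianReal 0 (vv σ))) ≤ 1 := by
  have hm : Measurable (fun y => ENNReal.ofReal (rr A L y / outf σ Q y)) :=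
    ((meas_rr A L).div (meas_outf σ Q)).ennreal_ofReal
  have h : (Q.prod (gaussianReal 0 (vv σ))).map (fun p => p.1 + p.2) =
      volume.withDensity (outF σ Q) := by
    rw [← jointLaw_snd hσ]
    unfold jointLaw
    rw [Measure.map_map (by fun_prop) (by fun_prop)]
    rfl
  rw [← lintegral_map (f := fun y => ENNReal.ofReal (rr A L y / outf σ Q y)) (g := fun p : ℝ × ℝ => p.1 + p.2) hm (by fun_prop), h,
    lintegral_withDensity_eq_lintegral_mul _ (meas_outF σ Q) hm]
  refine le_trans (le_of_eq ?_) (lint_rr hA hL)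
  refine lintegral_congr fun y => ?_
  have hp := outf_pos hσ Q hQ y
  have : outF σ Q y = ENNReal.ofReal (outf σ Q y) :=
    (ENNReal.ofReal_toReal (outF_ne_top σ Q y)).symm
  rw [Pi.mul_apply, this, ← ENNReal.ofReal_mul hp.le, mul_div_cancel₀ _ hp.ne']

lemma mi_upper {σ A L : ℝ} (hσ : 0 < σ) (hA : 0 < A) (hL : 0 < L) (Q : Measure ℝ)
    [IsProbabilityMeasure Q] (hQ : Q (Icc 0 A) = 1) :
    mutualInfo σ Q ≤ ((KK σ + Real.log (A + 2 * L) +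
      (∫ z, |z| ∂(gaussianReal 0 (vv σ))) / L : ℝ) : EReal) := by
  rw [mi_eq hσ hA Q hQ, EReal.coe_le_coe_iff]
  have hl := lint_ratio hσ hA hL Q hQ
  have hf := int_logf hσ hA Q hQ
  have hpos : ∀ y, 0 < rr A L y := fun y => by unfold rr; positivity
  have hnn : 0 ≤ᵐ[Q.prod (gaussianReal 0 (vv σ))] fun p : ℝ × ℝ =>
      rr A L (p.1 + p.2) / outf σ Q (p.1 + p.2) :=
    ae_of_all _ fun p => (div_pos (hpos _) (outf_pos hσ Q hQ _)).le
  have hm : Measurable (fun p : ℝ × ℝ => rr A L (p.1 + p.2) / outf σ Q (p.1 + p.2)) :=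
    ((meas_rr A L).div (meas_outf σ Q)).comp (measurable_fst.add measurable_snd)
  have hi : Integrable (fun p : ℝ × ℝ => rr A L (p.1 + p.2) / outf σ Q (p.1 + p.2))
      (Q.prod (gaussianReal 0 (vv σ))) := by
    refine ⟨hm.aestronglyMeasurable, ?_⟩
    rw [hasFiniteIntegral_iff_ofReal hnn]
    exact hl.trans_lt ENNReal.one_lt_top
  have hle : ∫ p : ℝ × ℝ, rr A L (p.1 + p.2) / outf σ Q (p.1 + p.2)
      ∂(Q.prod (gaussianReal 0 (vv σ))) ≤ 1 := by
    rw [integral_eq_lintegral_of_nonneg_ae hnn hm.aestronglyMeasurable]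
    exact ENNReal.toReal_le_of_le_ofReal zero_le_one (by simpa using hl)
  have hz : Integrable (fun p : ℝ × ℝ => |p.2| / L) (Q.prod (gaussianReal 0 (vv σ))) :=
    ((int_abs σ).comp_snd Q).div_const _
  have hc : Integrable (fun p : ℝ × ℝ => Real.log (A + 2 * L) - 1) (Q.prod (gaussianReal 0 (vv σ))) :=
    integrable_const _
  have hcz : Integrable (fun p : ℝ × ℝ => (Real.log (A + 2 * L) - 1) + |p.2| / L)
    (Q.prod (gaussianReal 0 (vv σ))) := hc.add hz
  have key : ∫ p : ℝ × ℝ, -Real.log (outf σ Q (p.1 + p.2)) ∂(Q.prod (gaussianReal 0 (vv σ))) ≤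
      ∫ p : ℝ × ℝ, (((Real.log (A + 2 * L) - 1) + |p.2| / L) +
        rr A L (p.1 + p.2) / outf σ Q (p.1 + p.2)) ∂(Q.prod (gaussianReal 0 (vv σ))) := by
    refine integral_mono_ae hf.neg (hcz.add hi) ?_
    have hx : ∀ᵐ p ∂(Q.prod (gaussianReal 0 (vv σ))), p.1 ∈ Icc 0 A :=
      Measure.quasiMeasurePreserving_fst.ae (ae_mem Q hQ)
    filter_upwards [hx] with p hp
    have h1 := Real.log_le_sub_one_of_pos (div_pos (hpos (p.1 + p.2)) (outf_pos hσ Q hQ (p.1 + p.2)))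
    rw [Real.log_div (hpos _).ne' (outf_pos hσ Q hQ _).ne'] at h1
    have h2 : Real.log (rr A L (p.1 + p.2)) = -Real.log (A + 2 * L) - dd A (p.1 + p.2) / L := by
      unfold rr
      rw [Real.log_mul (by positivity) (by positivity), Real.log_exp, Real.log_inv]; ring
    have h3 : dd A (p.1 + p.2) / L ≤ |p.2| / L := by
      gcongr
      unfold dd
      refine max_le (abs_nonneg _) (max_le ?_ ?_)
      · linarith [neg_abs_le p.2, hp.1]
      · linarith [le_abs_self p.2, hp.2]
    linarith
  rw [integral_neg, integral_add hcz hi, integral_add hc hz,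
    integral_fun_snd (fun z => |z| / L), integral_div] at key
  simp at key
  linarith

noncomputable def UU (A : ℝ) : Measure ℝ := (ENNReal.ofReal A)⁻¹ • volume.restrict (Icc 0 A)

lemma UU_prob {A : ℝ} (hA : 0 < A) : IsProbabilityMeasure (UU A) := by
  constructor
  simp [UU]
  exact ENNReal.inv_mul_cancel (by simpa using hA) ENNReal.ofReal_ne_top

lemma UU_Icc {A : ℝ} (hA : 0 < A) : UU A (Icc 0 A) = 1 := by
  simp [UU]
  exact ENNReal.inv_mul_cancel (by simpa using hA) ENNReal.ofReal_ne_top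

lemma UU_mean {A : ℝ} (hA : 0 < A) : ∫⁻ x, ENNReal.ofReal x ∂(UU A) = ENNReal.ofReal (A / 2) := by
  unfold UU
  rw [lintegral_smul_measure, ← ofReal_integral_eq_lintegral_ofReal]
  · rw [integral_Icc_eq_integral_Ioc, ← intervalIntegral.integral_of_le hA.le, integral_id,
      smul_eq_mul, ← ENNReal.ofReal_inv_of_pos hA, ← ENNReal.ofReal_mul (by positivity)]
    congr 1; field_simp; ring
  · exact continuous_id.integrableOn_Icc
  · filter_upwards [ae_restrict_mem measurableSet_Icc] with x hx using hx.1

lemma outf_UU {σ A : ℝ} (hσ : 0 < σ) (hA : 0 < A) (y : ℝ) : outf σ (UU A) y ≤ A⁻¹ := by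
  refine ENNReal.toReal_le_of_le_ofReal (by positivity) ?_
  unfold outF UU
  rw [lintegral_smul_measure, ENNReal.ofReal_inv_of_pos hA, smul_eq_mul]
  refine mul_le_of_le_one_right' ?_
  refine (setLIntegral_le_lintegral _ _).trans ?_
  rw [← lintegral_gaussianPDF_eq_one y (vv_ne hσ)]
  refine le_of_eq (lintegral_congr fun x => ?_)
  unfold gaussianPDF gaussianPDFReal
  rw [show (y - x) ^ 2 = (x - y) ^ 2 by ring]

lemma mi_lower {σ A : ℝ} (hσ : 0 < σ) (hA : 0 < A) :
    ((KK σ + Real.log A : ℝ) : EReal) ≤ mutualInfo σ (UU A) := by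
  have := UU_prob hA
  rw [mi_eq hσ hA (UU A) (UU_Icc hA), EReal.coe_le_coe_iff]
  have h : ∫ p : ℝ × ℝ, Real.log (outf σ (UU A) (p.1 + p.2)) ∂((UU A).prod (gaussianReal 0 (vv σ)))
      ≤ ∫ p : ℝ × ℝ, -Real.log A ∂((UU A).prod (gaussianReal 0 (vv σ))) := by
    refine integral_mono (int_logf hσ hA _ (UU_Icc hA)) (integrable_const _) fun p => ?_
    have := Real.log_le_log (outf_pos hσ _ (UU_Icc hA) (p.1 + p.2)) (outf_UU hσ hA (p.1 + p.2))
    rwa [Real.log_inv] at this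
  simp at h
  linarith

/-- High-power asymptotics of `C(A, αA)` for `1/2 ≤ α ≤ 1`:
`C(A, αA) − log(A/σ) → −(1/2) log(2πe)` as `A → ∞`. -/
theorem capacity_high_power_asymptotics_weak (σ α : ℝ) (hσ : 0 < σ)
    (hα₁ : 1 / 2 ≤ α) (hα₂ : α ≤ 1) :
    Tendsto (fun A : ℝ => capacity σ A (α * A) - ((Real.log (A / σ) : ℝ) : EReal)) atTop
      (𝓝 ((-(1 / 2) * Real.log (2 * π * rexp 1) : ℝ) : EReal)) := by

  set M := ∫ z, |z| ∂(gaussianReal 0 (vv σ)) with hM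
  set K' := -(1 / 2) * Real.log (2 * π * rexp 1) with hK'
  have hup : Tendsto (fun A : ℝ => K' + Real.log (1 + 2 * (√A)⁻¹) + M * (√A)⁻¹) atTop (𝓝 K') := by
    have h0 : Tendsto (fun A : ℝ => (√A)⁻¹) atTop (𝓝 0) :=
      tendsto_inv_atTop_zero.comp Real.tendsto_sqrt_atTop
    have h1 : Tendsto (fun A : ℝ => 1 + 2 * (√A)⁻¹) atTop (𝓝 1) := by
      simpa using (h0.const_mul 2).const_add 1
    have h2 := h1.log one_ne_zero
    simpa using (h2.const_add K').add (h0.const_mul M)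
  refine tendsto_of_tendsto_of_tendsto_of_le_of_le' tendsto_const_nhds
    ((continuous_coe_real_ereal.tendsto _).comp hup) ?_ ?_
  · filter_upwards [eventually_gt_atTop 0] with A hA
    rw [EReal.le_sub_iff_add_le (by simp) (by simp), ← EReal.coe_add]
    have e : K' + Real.log (A / σ) = KK σ + Real.log A := by
      rw [Real.log_div hA.ne' hσ.ne', KK]; ring
    rw [e]
    refine (mi_lower hσ hA).trans ?_
    unfold capacity
    refine le_iSup₂_of_le (UU A) ⟨UU_prob hA, UU_Icc hA, ?_⟩ le_rfl
    rw [UU_mean hA]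
    apply ENNReal.ofReal_le_ofReal
    nlinarith
  · filter_upwards [eventually_gt_atTop 0] with A hA
    refine EReal.sub_le_of_le_add ?_
    simp only [Function.comp_apply]
    rw [← EReal.coe_add]
    unfold capacity
    refine iSup₂_le fun Q hQ => ?_
    have := hQ.1
    have hs : 0 < √A := Real.sqrt_pos.2 hA
    refine (mi_upper hσ hA hs Q hQ.2.1).trans (le_of_eq ?_)
    congr 1
    have e1 : A + 2 * √A = A * (1 + 2 * (√A)⁻¹) := by
      have := Real.mul_self_sqrt hA.le
      field_simp
      nlinarith
    rw [e1, Real.log_mul hA.ne' (by positivity), Real.log_div hA.ne' hσ.ne', KK]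
    ring
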